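/- arXiv:1807.00197 — 3 statements merged into one kernel-verified Lean document; each statement's English description precedes it below -/
import Mathlib

section
/- For all real t₀ ≥ 0 and all t ≥ t₀ + 1, one has ∫_{t₀}^{t} (t−s)^{−3/4} s^{−1/2} ds ≤ 6·2^{1/4}. (The convolution-integral bound used in the proof of Theorem 3.1.) -/
open MeasureTheory Real Filter Topology

noncomputable section

/-- On the half of `(0, 2m)` near the singularity at `0`, the factor `(2m - s) ^ q` with `q ≤ 0` is
at most `m ^ q`, so the beta-type integrand is integrable with an explicit bound. -/
lemma intervalIntegral_beta_half_le {m p q : ℝ} (hm : 0 < m) (hp : -1 < p) (hq : q ≤ 0) :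
    IntervalIntegrable (fun s : ℝ => (2 * m - s) ^ q * s ^ p) volume 0 m ∧
    ∫ s in (0:ℝ)..m, (2 * m - s) ^ q * s ^ p ≤ m ^ (p + q + 1) / (p + 1) := by
  have hle : ∀ s ∈ Set.Ioc 0 m, (2 * m - s) ^ q * s ^ p ≤ m ^ q * s ^ p := fun s hs =>
    mul_le_mul_of_nonneg_right
      (rpow_le_rpow_of_nonpos hm (by linarith [hs.2]) hq) (rpow_nonneg hs.1.le _)
  have hg : IntervalIntegrable (fun s : ℝ => m ^ q * s ^ p) volume 0 m :=
    (intervalIntegral.intervalIntegrable_rpow' hp).const_mul _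
  have hf : IntervalIntegrable (fun s : ℝ => (2 * m - s) ^ q * s ^ p) volume 0 m := by
    refine hg.mono_fun' (by fun_prop) ?_
    rw [Set.uIoc_of_le hm.le]
    filter_upwards [ae_restrict_mem measurableSet_Ioc] with s hs
    rw [norm_of_nonneg (mul_nonneg (rpow_nonneg (by linarith [hs.1, hs.2]) _)
      (rpow_nonneg hs.1.le _))]
    exact hle s hs
  refine ⟨hf, ?_⟩
  calc ∫ s in (0:ℝ)..m, (2 * m - s) ^ q * s ^ p
      ≤ ∫ s in (0:ℝ)..m, m ^ q * s ^ p :=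
        intervalIntegral.integral_mono_on_of_le_Ioo hm.le hf hg
          fun s hs => hle s ⟨hs.1, hs.2.le⟩
    _ = m ^ (p + q + 1) / (p + 1) := by
        rw [intervalIntegral.integral_const_mul, integral_rpow (Or.inl hp),
          zero_rpow (by linarith), sub_zero, ← mul_div_assoc, ← rpow_add hm]
        ring_nf

/-- The convolution-integral bound used in the proof of Theorem 3.1:
for `t₀ ≥ 0` and `t ≥ t₀ + 1`, `∫_{t₀}^{t} (t−s)^{−3/4} s^{−1/2} ds ≤ 6·2^{1/4}`. -/
theorem convolution_integral_bound
    (t₀ t : ℝ) (h0 : 0 ≤ t₀) (ht : t₀ + 1 ≤ t) :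
    IntegrableOn (fun s => (t - s) ^ (-(3:ℝ)/4) * s ^ (-(1:ℝ)/2)) (Set.Ioo t₀ t) volume ∧
    ∫ s in Set.Ioo t₀ t, (t - s) ^ (-(3:ℝ)/4) * s ^ (-(1:ℝ)/2)
      ≤ 6 * (2:ℝ) ^ ((1:ℝ)/4) := by
  obtain ⟨m, rfl⟩ : ∃ m, t = 2 * m := ⟨t / 2, by ring⟩
  have hm : 1 / 2 ≤ m := by linarith
  have hm0 : 0 < m := by linarith
  set f : ℝ → ℝ := fun s => (2 * m - s) ^ (-(3:ℝ)/4) * s ^ (-(1:ℝ)/2) with hf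
  obtain ⟨i1, b1⟩ := intervalIntegral_beta_half_le (p := -(1:ℝ)/2) (q := -(3:ℝ)/4) hm0
    (by norm_num) (by norm_num)
  obtain ⟨i2, b2⟩ := intervalIntegral_beta_half_le (p := -(3:ℝ)/4) (q := -(1:ℝ)/2) hm0
    (by norm_num) (by norm_num)
  have hrefl : (fun s : ℝ => (2 * m - s) ^ (-(1:ℝ)/2) * s ^ (-(3:ℝ)/4)) =
      fun s => f (2 * m - s) := by
    funext s
    simp only [hf, sub_sub_cancel, mul_comm]
  have hsub : 2 * m - m = m := by ring
  have i2' : IntervalIntegrable f volume m (2 * m) := by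
    have := i2.comp_sub_left (2 * m)
    simp only [sub_sub_cancel, sub_zero, hsub] at this
    refine this.symm.congr fun s _ => ?_
    simp only [hf, mul_comm]
  have b2' : ∫ s in m..2 * m, f s ≤ m ^ (-(3:ℝ)/4 + -(1:ℝ)/2 + 1) / (-(3:ℝ)/4 + 1) := by
    rw [hrefl, intervalIntegral.integral_comp_sub_left f, hsub, sub_zero] at b2
    exact b2
  have i := i1.trans i2'
  have iOn : IntegrableOn f (Set.Ioc 0 (2 * m)) volume :=
    (intervalIntegrable_iff_integrableOn_Ioc_of_le (by linarith)).1 i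
  have hss : Set.Ioo t₀ (2 * m) ⊆ Set.Ioc 0 (2 * m) := fun s hs =>
    ⟨h0.trans_lt hs.1, hs.2.le⟩
  refine ⟨iOn.mono_set hss, ?_⟩
  calc ∫ s in Set.Ioo t₀ (2 * m), f s
      ≤ ∫ s in Set.Ioc 0 (2 * m), f s := by
        refine setIntegral_mono_set iOn ?_ hss.eventuallyLE
        filter_upwards [ae_restrict_mem measurableSet_Ioc] with s hs
        exact mul_nonneg (rpow_nonneg (by linarith [hs.2]) _) (rpow_nonneg hs.1.le _)
    _ = (∫ s in (0:ℝ)..m, f s) + ∫ s in m..2 * m, f s := by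
        rw [intervalIntegral.integral_add_adjacent_intervals i1 i2',
          intervalIntegral.integral_of_le (by linarith)]
    _ ≤ m ^ (-(1:ℝ)/2 + -(3:ℝ)/4 + 1) / (-(1:ℝ)/2 + 1)
        + m ^ (-(3:ℝ)/4 + -(1:ℝ)/2 + 1) / (-(3:ℝ)/4 + 1) := add_le_add b1 b2'
    _ = 6 * m ^ (-(1:ℝ)/4) := by
        norm_num
        ring
    _ ≤ 6 * (1 / 2 : ℝ) ^ (-(1:ℝ)/4) := by
        gcongr 6 * ?_
        exact rpow_le_rpow_of_nonpos (by norm_num) hm (by norm_num)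
    _ = 6 * (2:ℝ) ^ ((1:ℝ)/4) := by
        rw [one_div, inv_rpow (by norm_num), ← rpow_neg (by norm_num)]
        norm_num
end
end

section
/- Let K = (8π)^{−3/4}, let 0 < ε ≤ 1/2 and b ≥ 1, and let U : [b, 2b] → [0,∞) be continuous and satisfy, for all t ∈ (b, 2b], the inequality U(t) ≤ Kε + Kε · b^{−1/2} (t−b)^{3/4} ∫_b^t (t−s)^{−3/4} (s−b)^{−3/4} U(s) ds. Then U(t) < 0.18 ε for all t ∈ [b, 2b]. (The scalar Volterra-type bootstrap lemma underlying the proof of Theorem 4.1.) -/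
open MeasureTheory Real Filter Topology

noncomputable section

theorem rpow_neg_mul_rpow_neg_le {x y p : ℝ} (hx : 0 < x) (hy : 0 < y) (hp : 0 ≤ p)
    (hp1 : p ≤ 1) : x ^ (-p) * y ^ (-p) ≤ (x + y) ^ (-p) * (y ^ (-p) + x ^ (-p)) := by
  have h : (x + y) ^ p ≤ x ^ p + y ^ p := Real.rpow_add_le_add_rpow hx.le hy.le hp hp1
  have hx' := Real.rpow_pos_of_pos hx p
  have hy' := Real.rpow_pos_of_pos hy p
  have hxy := Real.rpow_pos_of_pos (add_pos hx hy) p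
  rw [Real.rpow_neg hx.le, Real.rpow_neg hy.le, Real.rpow_neg (add_pos hx hy).le]
  field_simp
  linarith

theorem integrableOn_sub_rpow {b t r : ℝ} (hbt : b ≤ t) (hr : -1 < r) :
    IntegrableOn (fun s => (s - b) ^ r) (Set.Ioo b t) := by
  rw [← intervalIntegrable_iff_integrableOn_Ioo_of_le hbt]
  simpa using (intervalIntegral.intervalIntegrable_rpow' (a := 0) (b := t - b) hr).comp_sub_right b

theorem integrableOn_rsub_rpow {b t r : ℝ} (hbt : b ≤ t) (hr : -1 < r) :
    IntegrableOn (fun s => (t - s) ^ r) (Set.Ioo b t) := by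
  rw [← intervalIntegrable_iff_integrableOn_Ioo_of_le hbt]
  simpa using
    ((intervalIntegral.intervalIntegrable_rpow' (a := 0) (b := t - b) hr).comp_sub_left t).symm

theorem setIntegral_sub_rpow {b t r : ℝ} (hbt : b ≤ t) (hr : -1 < r) :
    ∫ s in Set.Ioo b t, (s - b) ^ r = (t - b) ^ (r + 1) / (r + 1) := by
  rw [← integral_Ioc_eq_integral_Ioo, ← intervalIntegral.integral_of_le hbt,
    intervalIntegral.integral_comp_sub_right (fun s => s ^ r), integral_rpow (Or.inl hr), sub_self,
    Real.zero_rpow (by linarith), sub_zero]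

theorem setIntegral_rsub_rpow {b t r : ℝ} (hbt : b ≤ t) (hr : -1 < r) :
    ∫ s in Set.Ioo b t, (t - s) ^ r = (t - b) ^ (r + 1) / (r + 1) := by
  rw [← integral_Ioc_eq_integral_Ioo, ← intervalIntegral.integral_of_le hbt,
    intervalIntegral.integral_comp_sub_left (fun s => s ^ r), integral_rpow (Or.inl hr), sub_self,
    Real.zero_rpow (by linarith), sub_zero]

theorem setIntegral_beta_kernel_mul_le {b t M : ℝ} {U : ℝ → ℝ} (hbt : b < t)
    (hU0 : ∀ s ∈ Set.Ioo b t, 0 ≤ U s) (hUM : ∀ s ∈ Set.Ioo b t, U s ≤ M) :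
    ∫ s in Set.Ioo b t, (t - s) ^ (-(3:ℝ)/4) * (s - b) ^ (-(3:ℝ)/4) * U s ≤
      8 * (t - b) ^ (-(3:ℝ)/4) * (t - b) ^ ((1:ℝ)/4) * M := by
  have hr : (-1 : ℝ) < -(3:ℝ)/4 := by norm_num
  have h1 := integrableOn_sub_rpow hbt.le hr
  have h2 := integrableOn_rsub_rpow hbt.le hr
  calc
    _ ≤ ∫ s in Set.Ioo b t, (t - b) ^ (-(3:ℝ)/4) * M *
          ((s - b) ^ (-(3:ℝ)/4) + (t - s) ^ (-(3:ℝ)/4)) := by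
      refine integral_mono_of_nonneg ?_ ((h1.add h2).const_mul _) ?_
      all_goals
        filter_upwards [ae_restrict_mem measurableSet_Ioo] with s hs
        have hs1 : 0 < s - b := sub_pos.2 hs.1
        have hs2 : 0 < t - s := sub_pos.2 hs.2
        have hU0s := hU0 s hs
      · simp only [Pi.zero_apply]
        positivity
      · have h := rpow_neg_mul_rpow_neg_le hs2 hs1 (p := 3 / 4) (by norm_num) (by norm_num)
        rw [← neg_div, sub_add_sub_cancel] at h
        calc
          _ ≤ (t - b) ^ (-(3:ℝ)/4) * ((s - b) ^ (-(3:ℝ)/4) + (t - s) ^ (-(3:ℝ)/4)) * M :=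
            mul_le_mul h (hUM s hs) hU0s ((by positivity : (0:ℝ) ≤ _).trans h)
          _ = _ := by ring
    _ = _ := by
      rw [integral_const_mul, integral_add h1 h2, setIntegral_sub_rpow hbt.le hr,
        setIntegral_rsub_rpow hbt.le hr]
      norm_num
      ring

theorem eight_pi_rpow_le : (8 * π) ^ (-(3:ℝ)/4) ≤ 1 / 10 := by
  have h24 : (24 : ℝ) ≤ 8 * π := by linarith [Real.pi_gt_three]
  have h10 : (10 : ℝ) ≤ (8 * π) ^ ((3:ℝ)/4) := by
    refine le_of_pow_le_pow_left₀ (n := 4) (by norm_num) (by positivity) ?_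
    rw [← Real.rpow_mul_natCast (by positivity)]
    norm_num
    calc (10000 : ℝ) ≤ 24 ^ 3 := by norm_num
      _ ≤ (8 * π) ^ 3 := by gcongr
  rw [neg_div, Real.rpow_neg (by positivity), one_div]
  gcongr

theorem rpow_neg_half_mul_rpow_quarter_le_one {b x : ℝ} (hb : 1 ≤ b) (hx : 0 ≤ x) (hxb : x ≤ b) :
    b ^ (-(1:ℝ)/2) * x ^ ((1:ℝ)/4) ≤ 1 := by
  have hb0 : 0 < b := by linarith
  calc
    _ ≤ b ^ (-(1:ℝ)/2) * b ^ ((1:ℝ)/4) := by gcongr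
    _ = b ^ (-(1:ℝ)/4) := by rw [← Real.rpow_add hb0]; norm_num
    _ ≤ 1 := Real.rpow_le_one_of_one_le_of_nonpos hb (by norm_num)

/-- The scalar Volterra-type bootstrap lemma underlying the proof of Theorem 4.1:
with `K = (8π)^{−3/4}`, `0 < ε ≤ 1/2`, `b ≥ 1`, a continuous nonnegative `U` on `[b,2b]`
satisfying `U(t) ≤ Kε + Kε b^{−1/2} (t−b)^{3/4} ∫_b^t (t−s)^{−3/4}(s−b)^{−3/4} U(s) ds`
for `b < t ≤ 2b` satisfies `U(t) < 0.18 ε` on `[b,2b]`. -/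
theorem volterra_bootstrap_lemma
    (K ε b : ℝ) (hK : K = (8 * π) ^ (-(3:ℝ)/4))
    (hε : 0 < ε) (hε' : ε ≤ 1/2) (hb : 1 ≤ b)
    (U : ℝ → ℝ)
    (hUcont : ContinuousOn U (Set.Icc b (2 * b)))
    (hUpos : ∀ t ∈ Set.Icc b (2 * b), 0 ≤ U t)
    (hU : ∀ t, b < t → t ≤ 2 * b →
      U t ≤ K * ε + K * ε * b ^ (-(1:ℝ)/2) * (t - b) ^ ((3:ℝ)/4) *
        ∫ s in Set.Ioo b t, (t - s) ^ (-(3:ℝ)/4) * (s - b) ^ (-(3:ℝ)/4) * U s) :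
    ∀ t ∈ Set.Icc b (2 * b), U t < 0.18 * ε := by
  have hb2 : b < 2 * b := by linarith
  have hK0 : 0 ≤ K := hK ▸ by positivity
  have hK1 : K ≤ 1 / 10 := hK ▸ eight_pi_rpow_le
  obtain ⟨t₀, ht₀, hmax⟩ := isCompact_Icc.exists_isMaxOn (Set.nonempty_Icc.2 hb2.le) hUcont
  set M := U t₀
  have hM0 : 0 ≤ M := hUpos t₀ ht₀
  have hbound : ∀ t ∈ Set.Ioc b (2 * b), U t ≤ ε / 10 + 2 / 5 * M := by
    intro t ⟨hbt, ht2⟩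
    have hL : 0 < t - b := sub_pos.2 hbt
    have hI := setIntegral_beta_kernel_mul_le hbt
      (fun s hs => hUpos s ⟨hs.1.le, hs.2.le.trans ht2⟩)
      (fun s hs => hmax ⟨hs.1.le, hs.2.le.trans ht2⟩)
    have hcancel : (t - b) ^ ((3:ℝ)/4) * (t - b) ^ (-(3:ℝ)/4) = 1 := by
      rw [← Real.rpow_add hL]; norm_num
    have hone := rpow_neg_half_mul_rpow_quarter_le_one hb hL.le (by linarith)
    calc
      U t ≤ K * ε + K * ε * b ^ (-(1:ℝ)/2) * (t - b) ^ ((3:ℝ)/4) *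
          (8 * (t - b) ^ (-(3:ℝ)/4) * (t - b) ^ ((1:ℝ)/4) * M) :=
        (hU t hbt ht2).trans (by gcongr)
      _ = K * ε + 8 * (K * ε) * M * (b ^ (-(1:ℝ)/2) * (t - b) ^ ((1:ℝ)/4)) *
          ((t - b) ^ ((3:ℝ)/4) * (t - b) ^ (-(3:ℝ)/4)) := by ring
      _ ≤ 1 / 10 * ε + 8 * (1 / 10 * (1 / 2)) * M * 1 * 1 := by rw [hcancel]; gcongr
      _ = ε / 10 + 2 / 5 * M := by ring
  have hMbound : M ≤ ε / 10 + 2 / 5 * M := by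
    rw [← closure_Ioc hb2.ne] at ht₀ hUcont
    exact le_on_closure hbound hUcont continuousOn_const ht₀
  intro t ht
  have htM : U t ≤ M := hmax ht
  linarith
end
end

section
/- Let E > 0 and κ > 0, and let G, H : (0,∞) → [0,∞) with G continuous and all integrals below finite, such that: (i) ∫₀^∞ G(s)² ds ≤ E²/2; and (ii) for all 0 < t′ ≤ t, G(t)² + 2∫_{t′}^{t} H(s)² ds ≤ G(t′)² + 2 κ³ E^{1/2} ∫_{t′}^{t} G(s)^{1/2} H(s)² ds. Then for every t̂ > κ^{12} E⁴ / 2 there exists t** ∈ (0, t̂] such that κ³ E^{1/2} G(t)^{1/2} < 1 for all t ≥ t** and G is monotonically nonincreasing on [t**, ∞). In particular, with κ = 0.581862001307 one can find such a t** with t** < 0.000753026 · E⁴. (The quantitative core of Theorem A.1 / estimate (2.22), with G(t) = ‖Du(·,t)‖_{L²}, H(t) = ‖D²u(·,t)‖_{L²}, E = ‖u₀‖_{L²}.) -/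
open MeasureTheory Real Filter Topology

noncomputable section

/-- If the weight `K * √G` is at most `1` on `(a, b]`, then the energy inequality forces
`G b ≤ G a`. -/
theorem le_of_energy_inequality {G H : ℝ → ℝ} {K a b : ℝ}
    (hGa : 0 ≤ G a)
    (hH : IntegrableOn (fun s => H s ^ 2) (Set.Ioc a b) volume)
    (hGH : IntegrableOn (fun s => G s ^ ((1:ℝ)/2) * H s ^ 2) (Set.Ioc a b) volume)
    (hineq : G b ^ 2 + 2 * ∫ s in Set.Ioc a b, H s ^ 2
      ≤ G a ^ 2 + 2 * K * ∫ s in Set.Ioc a b, G s ^ ((1:ℝ)/2) * H s ^ 2)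
    (hK : ∀ s ∈ Set.Ioc a b, K * G s ^ ((1:ℝ)/2) ≤ 1) : G b ≤ G a := by
  have hint : K * ∫ s in Set.Ioc a b, G s ^ ((1:ℝ)/2) * H s ^ 2
      ≤ ∫ s in Set.Ioc a b, H s ^ 2 := by
    rw [← integral_const_mul]
    refine setIntegral_mono_on (hGH.const_mul K) hH measurableSet_Ioc fun s hs => ?_
    nlinarith [mul_le_mul_of_nonneg_right (hK s hs) (sq_nonneg (H s))]
  exact le_of_sq_le_sq (by linarith) hGa

/-- A function whose square integral over `(0, ∞)` is less than `b * c` has square less than `c`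
somewhere on `(0, b]`. -/
theorem exists_sq_lt_of_setIntegral_lt {G : ℝ → ℝ} {b c : ℝ} (hb : 0 < b)
    (hG : IntegrableOn (fun s => G s ^ 2) (Set.Ioi (0:ℝ)) volume)
    (hlt : ∫ s in Set.Ioi (0:ℝ), G s ^ 2 < b * c) : ∃ t ∈ Set.Ioc 0 b, G t ^ 2 < c := by
  by_contra! h
  have hconst : ∫ _ in Set.Ioc 0 b, c ≤ ∫ s in Set.Ioc 0 b, G s ^ 2 :=
    setIntegral_mono_on (by simp) (hG.mono_set Set.Ioc_subset_Ioi_self) measurableSet_Ioc h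
  have hmono : ∫ s in Set.Ioc 0 b, G s ^ 2 ≤ ∫ s in Set.Ioi (0:ℝ), G s ^ 2 :=
    setIntegral_mono_set hG (Eventually.of_forall fun s => sq_nonneg (G s))
      Set.Ioc_subset_Ioi_self.eventuallyLE
  simp [hb.le] at hconst
  linarith

/-- A continuous function on `[a, ∞)` starting below `c` stays below `c` as long as it cannot
return to a value above its initial one while staying at most `c`. -/
theorem forall_lt_of_forall_le_imp_le {f : ℝ → ℝ} {a c : ℝ} (hf : ContinuousOn f (Set.Ici a))
    (ha : f a < c) (h : ∀ b, a ≤ b → (∀ s ∈ Set.Ioc a b, f s ≤ c) → f b ≤ f a) :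
    ∀ t, a ≤ t → f t < c := by
  intro t hat
  by_contra! hct
  have hcont : ContinuousOn f (Set.Icc a t) := hf.mono Set.Icc_subset_Ici_self
  have hcomp : IsCompact (Set.Icc a t ∩ f ⁻¹' {c}) :=
    isCompact_Icc.of_isClosed_subset (hcont.preimage_isClosed_of_isClosed isClosed_Icc
      isClosed_singleton) Set.inter_subset_left
  obtain ⟨z, hz, hzc⟩ := intermediate_value_Icc hat hcont ⟨ha.le, hct⟩
  obtain ⟨s, ⟨⟨has, hst⟩, hsc⟩, hmin⟩ := hcomp.exists_isLeast ⟨z, hz, hzc⟩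
  have hle : ∀ y ∈ Set.Ioc a s, f y ≤ c := by
    intro y hy
    by_contra! hyc
    obtain ⟨w, hw, hwc⟩ := intermediate_value_Icc hy.1.le
      (hf.mono Set.Icc_subset_Ici_self) ⟨ha.le, hyc.le⟩
    have hsw : s ≤ w := hmin ⟨⟨hw.1, hw.2.trans (hy.2.trans hst)⟩, hwc⟩
    have hys : y = w := le_antisymm (hy.2.trans hsw) hw.2
    exact hyc.ne' (hys ▸ hwc)
  have hsc' : f s = c := hsc
  linarith [h s has hle]

/-- The quantitative core of Theorem A.1 / estimate (2.22): if `G` (think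
`‖Du(·,t)‖₂`) is continuous and nonnegative with `∫₀^∞ G² ≤ E²/2`, and the
differential-type inequality
`G(t)² + 2∫_{t'}^t H² ≤ G(t')² + 2κ³E^{1/2} ∫_{t'}^t G^{1/2} H²`
holds for all `0 < t' ≤ t`, then for every `t̂ > κ¹²E⁴/2` there is `t** ∈ (0,t̂]` with
`κ³E^{1/2}G(t)^{1/2} < 1` for all `t ≥ t**` and `G` nonincreasing on `[t**,∞)`;
in particular, for `κ = 0.581862001307` such a `t**` exists with
`t** < 0.000753026 E⁴`. -/
theorem eventual_monotonicity_of_gradient_norm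
    (E κ : ℝ) (hE : 0 < E) (hκ : 0 < κ)
    (G H : ℝ → ℝ)
    (hG0 : ∀ t, 0 < t → 0 ≤ G t) (hH0 : ∀ t, 0 < t → 0 ≤ H t)
    (hGcont : ContinuousOn G (Set.Ioi (0:ℝ)))
    (hGint : IntegrableOn (fun s => G s ^ 2) (Set.Ioi (0:ℝ)) volume)
    (hGE : ∫ s in Set.Ioi (0:ℝ), G s ^ 2 ≤ E ^ 2 / 2)
    (hHint : ∀ t' t : ℝ, 0 < t' → t' ≤ t →
      IntegrableOn (fun s => H s ^ 2) (Set.Ioc t' t) volume ∧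
      IntegrableOn (fun s => G s ^ ((1:ℝ)/2) * H s ^ 2) (Set.Ioc t' t) volume)
    (hineq : ∀ t' t : ℝ, 0 < t' → t' ≤ t →
      G t ^ 2 + 2 * ∫ s in Set.Ioc t' t, H s ^ 2
        ≤ G t' ^ 2 + 2 * κ ^ 3 * E ^ ((1:ℝ)/2) *
            ∫ s in Set.Ioc t' t, G s ^ ((1:ℝ)/2) * H s ^ 2) :
    (∀ that : ℝ, κ ^ 12 * E ^ 4 / 2 < that →
      ∃ tss : ℝ, 0 < tss ∧ tss ≤ that ∧
        (∀ t, tss ≤ t → κ ^ 3 * E ^ ((1:ℝ)/2) * G t ^ ((1:ℝ)/2) < 1) ∧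
        AntitoneOn G (Set.Ici tss)) ∧
    (κ = 0.581862001307 →
      ∃ tss : ℝ, 0 < tss ∧ tss < 0.000753026 * E ^ 4 ∧
        (∀ t, tss ≤ t → κ ^ 3 * E ^ ((1:ℝ)/2) * G t ^ ((1:ℝ)/2) < 1) ∧
        AntitoneOn G (Set.Ici tss)) := by
  set K := κ ^ 3 * E ^ ((1:ℝ)/2) with hKdef
  have hK : 0 < K := by positivity
  have hK4 : K ^ 4 = κ ^ 12 * E ^ 2 := by
    rw [hKdef, mul_pow, ← Real.rpow_mul_natCast hE.le]
    rw [show (1:ℝ) / 2 * (4 : ℕ) = (2 : ℕ) by norm_num, Real.rpow_natCast]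
    ring
  have hdecr : ∀ a b, 0 < a → a ≤ b →
      (∀ s ∈ Set.Ioc a b, K * G s ^ ((1:ℝ)/2) ≤ 1) → G b ≤ G a := fun a b ha hab hs =>
    le_of_energy_inequality (hG0 a ha) (hHint a b ha hab).1 (hHint a b ha hab).2
      (by simpa only [hKdef, mul_assoc] using hineq a b ha hab) hs
  have main : ∀ that : ℝ, κ ^ 12 * E ^ 4 / 2 < that →
      ∃ tss : ℝ, 0 < tss ∧ tss ≤ that ∧
        (∀ t, tss ≤ t → K * G t ^ ((1:ℝ)/2) < 1) ∧ AntitoneOn G (Set.Ici tss) := by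
    intro that hthat
    have hpos : 0 < that := lt_trans (by positivity) hthat
    have hlt : E ^ 2 / 2 < that * (1 / K ^ 4) := by
      rw [hK4, mul_one_div, lt_div_iff₀ (by positivity)]
      linarith
    obtain ⟨a, ⟨ha, hab⟩, hGa⟩ := exists_sq_lt_of_setIntegral_lt hpos hGint (hGE.trans_lt hlt)
    have hstart : K * G a ^ ((1:ℝ)/2) < 1 := by
      refine lt_of_pow_lt_pow_left₀ 4 zero_le_one ?_
      rw [mul_pow, ← Real.rpow_mul_natCast (hG0 a ha)]
      rw [lt_div_iff₀ (by positivity)] at hGa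
      norm_num
      linarith
    have hcont : ContinuousOn (fun t => K * G t ^ ((1:ℝ)/2)) (Set.Ici a) :=
      continuousOn_const.mul ((hGcont.mono fun t ht => ha.trans_le ht).rpow_const
        fun _ _ => Or.inr (by norm_num))
    have hbelow : ∀ t, a ≤ t → K * G t ^ ((1:ℝ)/2) < 1 :=
      forall_lt_of_forall_le_imp_le hcont hstart fun b hb hs =>
        mul_le_mul_of_nonneg_left (Real.rpow_le_rpow (hG0 b (ha.trans_le hb))
          (hdecr a b ha hb hs) (by norm_num)) hK.le
    exact ⟨a, ha, hab, hbelow, fun x hx y _ hxy => hdecr x y (ha.trans_le hx) hxy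
      fun s hs => (hbelow s (le_trans hx hs.1.le)).le⟩
  refine ⟨main, fun hκ' => ?_⟩
  have hnum : κ ^ 12 * E ^ 4 / 2 < 0.000753026 * E ^ 4 := by
    have hκ12 : κ ^ 12 / 2 < 0.000753026 := by rw [hκ']; norm_num
    linarith [mul_lt_mul_of_pos_right hκ12 (pow_pos hE 4)]
  obtain ⟨that, h₁, h₂⟩ := exists_between hnum
  obtain ⟨tss, hpos, hle, h⟩ := main that h₁
  exact ⟨tss, hpos, hle.trans_lt h₂, h⟩
end
end
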